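/- Let n ≤ 5 and let Ω be a nonempty open convex subset of ℝⁿ. Suppose there is a subgroup Γ of Aut(Ω) such that (a) Γ acts freely and properly discontinuously on Ω, (b) the action is cocompact, i.e., there is a compact set K ⊆ Ω with ⋃_{γ∈Γ} γ(K) = Ω, and (c) the linear part of every element of Γ has determinant 1. Then Ω = ℝⁿ. (The Markus conjecture holds for convex affine manifolds of dimension at most 5.) -/

import Mathlib

open Matrix Set Filter Topology Pointwise

noncomputable section

/-- The affine action on ℝⁿ of an (n+1)×(n+1) invertible matrix in affine form
(ℝⁿ is identified with the hyperplane x_{n+1} = 1). -/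
def affAct (n : ℕ) (g : GL (Fin (n + 1)) ℝ) (x : Fin n → ℝ) : Fin n → ℝ :=
  fun i => (∑ j : Fin n, g.val i.castSucc j.castSucc * x j) + g.val i.castSucc (Fin.last n)

/-- A matrix in GL(n+1,ℝ) has affine form if its last row is (0, …, 0, 1). -/
def IsAffineForm (n : ℕ) (g : GL (Fin (n + 1)) ℝ) : Prop :=
  (∀ j : Fin n, g.val (Fin.last n) j.castSucc = 0) ∧ g.val (Fin.last n) (Fin.last n) = 1

/-- Aut(Ω): the group (here: set) of affine transformations of ℝⁿ preserving Ω,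
realized as affine-form matrices in GL(n+1,ℝ). -/
def AutSet (n : ℕ) (Ω : Set (Fin n → ℝ)) : Set (GL (Fin (n + 1)) ℝ) :=
  {g | IsAffineForm n g ∧ affAct n g '' Ω = Ω}

/-- Aut⁰(Ω): the identity component of Aut(Ω). -/
def AutIdComp (n : ℕ) (Ω : Set (Fin n → ℝ)) : Set (GL (Fin (n + 1)) ℝ) :=
  connectedComponentIn (AutSet n Ω) 1

/-- The limit set Λ_G of a subset G of Aut(Ω). -/
def limitSet (n : ℕ) (Ω : Set (Fin n → ℝ)) (G : Set (GL (Fin (n + 1)) ℝ)) :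
    Set (Fin n → ℝ) :=
  {ξ | ξ ∈ frontier Ω ∧ ∃ x ∈ Ω, ∃ u : ℕ → GL (Fin (n + 1)) ℝ,
    (∀ k, u k ∈ G) ∧ Filter.Tendsto (fun k => affAct n (u k) x) Filter.atTop (nhds ξ)}

/-- Ω is a convex affine domain: a nonempty open convex subset of ℝⁿ. -/
def IsConvexDomain (n : ℕ) (Ω : Set (Fin n → ℝ)) : Prop :=
  Ω.Nonempty ∧ IsOpen Ω ∧ Convex ℝ Ω

/-- Ω contains no complete affine line. -/
def HasNoLine (n : ℕ) (Ω : Set (Fin n → ℝ)) : Prop :=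
  ¬ ∃ x ∈ Ω, ∃ v : Fin n → ℝ, v ≠ 0 ∧ ∀ t : ℝ, x + t • v ∈ Ω

/-- Ω is a properly convex affine domain. -/
def IsProperlyConvexDomain (n : ℕ) (Ω : Set (Fin n → ℝ)) : Prop :=
  IsConvexDomain n Ω ∧ HasNoLine n Ω

/-- Ω is quasi-homogeneous: some compact K ⊆ Ω has ⋃_{g ∈ Aut(Ω)} g(K) = Ω. -/
def IsQuasiHomogeneous (n : ℕ) (Ω : Set (Fin n → ℝ)) : Prop :=
  ∃ K : Set (Fin n → ℝ), IsCompact K ∧ K ⊆ Ω ∧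
    (⋃ g ∈ AutSet n Ω, affAct n g '' K) = Ω

/-- Aut(Ω) is irreducible: it preserves no nonempty proper affine subspace of ℝⁿ. -/
def IsIrreducibleAut (n : ℕ) (Ω : Set (Fin n → ℝ)) : Prop :=
  ¬ ∃ S : AffineSubspace ℝ (Fin n → ℝ), (S : Set (Fin n → ℝ)).Nonempty ∧
      (S : Set (Fin n → ℝ)) ≠ Set.univ ∧
      ∀ g ∈ AutSet n Ω, affAct n g '' (S : Set (Fin n → ℝ)) = (S : Set (Fin n → ℝ))

/-- The asymptotic cone AC(Ω). -/
def asympCone (n : ℕ) (Ω : Set (Fin n → ℝ)) : Set (Fin n → ℝ) :=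
  {u | ∀ x ∈ Ω, ∀ t : ℝ, 0 ≤ t → x + t • u ∈ Ω}

/-- Ω is a cone with some vertex v. -/
def IsCone (n : ℕ) (Ω : Set (Fin n → ℝ)) : Prop :=
  ∃ v : Fin n → ℝ, ∀ x ∈ Ω, ∀ t : ℝ, 0 < t → v + t • (x - v) ∈ Ω

/-- Two subsets of ℝⁿ are affinely equivalent. -/
def AffinelyEquivalent (n : ℕ) (Ω Ω' : Set (Fin n → ℝ)) : Prop :=
  ∃ e : (Fin n → ℝ) ≃ᵃ[ℝ] (Fin n → ℝ), e '' Ω = Ω'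

/-- Γ acts freely on Ω. -/
def ActsFreely (n : ℕ) (Ω : Set (Fin n → ℝ)) (Γ : Set (GL (Fin (n + 1)) ℝ)) : Prop :=
  ∀ γ ∈ Γ, γ ≠ 1 → ∀ x ∈ Ω, affAct n γ x ≠ x

/-- Γ acts properly discontinuously on Ω. -/
def ActsProperlyDiscontinuously (n : ℕ) (Ω : Set (Fin n → ℝ))
    (Γ : Set (GL (Fin (n + 1)) ℝ)) : Prop :=
  ∀ K L : Set (Fin n → ℝ), K ⊆ Ω → L ⊆ Ω → IsCompact K → IsCompact L →
    {γ ∈ Γ | (affAct n γ '' K ∩ L).Nonempty}.Finite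

/-- Γ acts cocompactly on Ω. -/
def ActsCocompactly (n : ℕ) (Ω : Set (Fin n → ℝ)) (Γ : Set (GL (Fin (n + 1)) ℝ)) : Prop :=
  ∃ K : Set (Fin n → ℝ), IsCompact K ∧ K ⊆ Ω ∧ (⋃ γ ∈ Γ, affAct n γ '' K) = Ω

/-- The linear part of an affine-form matrix has determinant one. -/
def LinearPartDetOne (n : ℕ) (g : GL (Fin (n + 1)) ℝ) : Prop :=
  (Matrix.of fun i j : Fin n => g.val i.castSucc j.castSucc).det = 1

/-- In an open convex set, a direction in which some point recedes is one in which every point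
recedes. -/
lemma mem_asympCone_of_ray {n : ℕ} {Ω : Set (Fin n → ℝ)} (ho : IsOpen Ω) (hc : Convex ℝ Ω)
    {x u : Fin n → ℝ} (h : ∀ t : ℝ, 0 ≤ t → x + t • u ∈ Ω) : u ∈ asympCone n Ω := by
  intro y hy t ht
  have hcont : Tendsto (fun ε : ℝ => y + ε • (y - x)) (𝓝[>] 0) (𝓝 y) := by
    have : Continuous (fun ε : ℝ => y + ε • (y - x)) := by fun_prop
    have h2 := (this.tendsto 0).mono_left (nhdsWithin_le_nhds (s := Ioi 0))
    simpa using h2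
  obtain ⟨ε, hεΩ, hε⟩ := ((hcont.eventually (ho.mem_nhds hy)).and self_mem_nhdsWithin).exists
  have hε : 0 < ε := hε
  have h1 := hc hεΩ (h (t * (1 + ε) / ε) (by positivity)) (a := 1 / (1 + ε)) (b := ε / (1 + ε))
    (by positivity) (by positivity) (by field_simp)
  convert h1 using 1
  ext i
  simp only [Pi.add_apply, Pi.smul_apply, Pi.sub_apply, smul_eq_mul]
  field_simp
  ring

lemma asympCone_add_mem {n : ℕ} {Ω : Set (Fin n → ℝ)} {u v : Fin n → ℝ}
    (hu : u ∈ asympCone n Ω) (hv : v ∈ asympCone n Ω) : u + v ∈ asympCone n Ω := by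
  intro x hx t ht
  have := hv _ (hu x hx t ht) t ht
  rwa [add_assoc, ← smul_add] at this

lemma asympCone_smul_mem {n : ℕ} {Ω : Set (Fin n → ℝ)} {u : Fin n → ℝ}
    (hu : u ∈ asympCone n Ω) {c : ℝ} (hc : 0 ≤ c) : c • u ∈ asympCone n Ω := by
  intro x hx t ht
  have := hu x hx (t * c) (by positivity)
  rwa [mul_smul] at this

lemma asympCone_zero_mem {n : ℕ} {Ω : Set (Fin n → ℝ)} : (0 : Fin n → ℝ) ∈ asympCone n Ω := by
  intro x hx t _
  simpa using hx

lemma asympCone_sum_mem {n : ℕ} {Ω : Set (Fin n → ℝ)} {ι : Type*} (s : Finset ι)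
    (v : ι → Fin n → ℝ) (hv : ∀ i ∈ s, v i ∈ asympCone n Ω) : ∑ i ∈ s, v i ∈ asympCone n Ω := by
  classical
  induction s using Finset.induction_on with
  | empty => simpa using asympCone_zero_mem
  | insert a s ha ih =>
    rw [Finset.sum_insert ha]
    exact asympCone_add_mem (hv a (by simp)) (ih fun i hi => hv i (by simp [hi]))

/-- A sum of directions in the asymptotic cone is reversible only if each of them is. -/
lemma neg_sum_notMem_asympCone {n : ℕ} {Ω : Set (Fin n → ℝ)} {ι : Type*} (s : Finset ι)
    (v : ι → Fin n → ℝ) (hv : ∀ i ∈ s, v i ∈ asympCone n Ω) {i : ι} (hi : i ∈ s)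
    (hneg : -v i ∉ asympCone n Ω) : -(∑ i ∈ s, v i) ∉ asympCone n Ω := by
  classical
  intro h
  apply hneg
  have h2 := asympCone_add_mem h
    (asympCone_sum_mem (s.erase i) v fun j hj => hv j (Finset.mem_of_mem_erase hj))
  rw [← Finset.add_sum_erase s v hi] at h2
  convert h2 using 1
  abel

/-- If the asymptotic cone of an open convex set is symmetric, then the set is bounded modulo its
asymptotic cone, so reflections in points of a compact subset can be rescaled to stay inside. -/
lemma exists_reflection_mem {n : ℕ} {Ω : Set (Fin n → ℝ)} (ho : IsOpen Ω) (hc : Convex ℝ Ω)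
    (hsymm : ∀ u ∈ asympCone n Ω, -u ∈ asympCone n Ω) {K : Set (Fin n → ℝ)} (hK : IsCompact K)
    (hKΩ : K ⊆ Ω) : ∃ lam : ℝ, 0 < lam ∧ ∀ x ∈ K, ∀ y ∈ Ω, x + lam • (x - y) ∈ Ω := by
  rcases Ω.eq_empty_or_nonempty with rfl | ⟨x₀, hx₀⟩
  · exact ⟨1, one_pos, fun x hx => (hKΩ hx).elim⟩
  let L : Submodule ℝ (Fin n → ℝ) :=
    { carrier := asympCone n Ω
      add_mem' := asympCone_add_mem
      zero_mem' := asympCone_zero_mem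
      smul_mem' := by
        intro c u hu
        rcases le_total 0 c with h | h
        · exact asympCone_smul_mem hu h
        · have := asympCone_smul_mem (hsymm u hu) (neg_nonneg.2 h)
          simpa using this }
  obtain ⟨W, hW⟩ := L.exists_isCompl
  let P : (Fin n → ℝ) →ₗ[ℝ] (Fin n → ℝ) := W.subtype ∘ₗ W.projectionOnto L hW.symm
  have hPW : ∀ x, P x ∈ W := fun x => (W.projectionOnto L hW.symm x).2
  have hPL : ∀ x, x - P x ∈ L := by
    intro x
    have : W.projectionOnto L hW.symm (x - P x) = 0 := by
      rw [map_sub, sub_eq_zero]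
      exact (W.projectionOnto_apply_left hW.symm (W.projectionOnto L hW.symm x)).symm
    exact (Submodule.projectionOnto_apply_eq_zero_iff hW.symm).1 this
  have hmove : ∀ x ∈ Ω, ∀ l ∈ L, x + l ∈ Ω := by
    intro x hx l hl
    simpa using hl x hx 1 zero_le_one
  have hbdd : ∃ R : ℝ, ∀ y ∈ Ω, ‖P (y - x₀)‖ ≤ R := by
    by_contra! hcon
    choose y hyΩ hyR using fun j : ℕ => hcon (j + 1)
    let z : ℕ → (Fin n → ℝ) := fun j => P (y j - x₀)
    have hzpos : ∀ j, 0 < ‖z j‖ := fun j => lt_trans (by positivity) (hyR j)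
    have hv : ∀ j, (‖z j‖⁻¹ • z j) ∈ Metric.sphere (0 : Fin n → ℝ) 1 := by
      intro j
      simp [norm_smul, (hzpos j).ne']
    obtain ⟨v, hvs, φ, hφ, hlim⟩ := (isCompact_sphere (0 : Fin n → ℝ) 1).tendsto_subseq hv
    have hvW : v ∈ W := by
      have hclosed : IsClosed (W : Set (Fin n → ℝ)) := W.closed_of_finiteDimensional
      exact hclosed.mem_of_tendsto hlim (Eventually.of_forall fun j => W.smul_mem _ (hPW _))
    have hzΩ : ∀ j, x₀ + z j ∈ Ω := by
      intro j
      have := hmove _ (hyΩ j) _ (L.neg_mem (hPL (y j - x₀)))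
      convert this using 1
      simp only [z]
      abel
    have hclos : ∀ t : ℝ, 0 ≤ t → x₀ + t • v ∈ closure Ω := by
      intro t ht
      have hl : Tendsto (fun j => x₀ + t • (‖z (φ j)‖⁻¹ • z (φ j))) atTop (𝓝 (x₀ + t • v)) :=
        tendsto_const_nhds.add (hlim.const_smul t)
      refine mem_closure_of_tendsto hl ?_
      filter_upwards [eventually_ge_atTop ⌈t⌉₊] with j hj
      have h1 : t ≤ ‖z (φ j)‖ := by
        have h2 : (⌈t⌉₊ : ℝ) ≤ j := by exact_mod_cast hj
        have h3 : (j : ℝ) ≤ φ j := by exact_mod_cast hφ.id_le j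
        linarith [Nat.le_ceil t, hyR (φ j)]
      have h4 := hc hx₀ (hzΩ (φ j)) (a := 1 - t * ‖z (φ j)‖⁻¹) (b := t * ‖z (φ j)‖⁻¹)
        (by rw [sub_nonneg, ← div_eq_mul_inv, div_le_one (hzpos _)]; exact h1) (by positivity)
        (by ring)
      convert h4 using 1
      ext i
      simp only [Pi.add_apply, Pi.smul_apply, smul_eq_mul]
      ring
    have hvL : v ∈ L := by
      refine mem_asympCone_of_ray ho hc (x := x₀) fun t ht => ?_
      have h1 := hc.openSegment_interior_closure_subset_interior
        (by rwa [ho.interior_eq]) (hclos (2 * t) (by positivity))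
        (show x₀ + t • v ∈ openSegment ℝ x₀ (x₀ + (2 * t) • v) from
          ⟨1 / 2, 1 / 2, by norm_num, by norm_num, by norm_num, by
            ext i
            simp only [Pi.add_apply, Pi.smul_apply, smul_eq_mul]
            ring⟩)
      exact interior_subset h1
    have hv0 : v = 0 := by
      have := hW.disjoint.le_bot (Submodule.mem_inf.2 ⟨hvL, hvW⟩)
      simpa using this
    simp [hv0] at hvs
  obtain ⟨R, hR⟩ := hbdd
  obtain ⟨r, hr, hrΩ⟩ := hK.exists_cthickening_subset_open ho hKΩ
  have hR0 : 0 ≤ R := (norm_nonneg _).trans (hR x₀ hx₀)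
  refine ⟨r / (2 * R + 1), by positivity, fun x hx y hy => ?_⟩
  set lam := r / (2 * R + 1) with hlam
  have hlpos : 0 < lam := by positivity
  have h1 : x + lam • P (x - y) ∈ Ω := by
    apply hrΩ
    refine Metric.mem_cthickening_of_dist_le _ x r K hx ?_
    rw [dist_eq_norm, add_sub_cancel_left, norm_smul, Real.norm_of_nonneg hlpos.le]
    have h2 : ‖P (x - y)‖ ≤ 2 * R := by
      have : x - y = (x - x₀) - (y - x₀) := by abel
      rw [this, map_sub]
      linarith [norm_sub_le (P (x - x₀)) (P (y - x₀)), hR x (hKΩ hx), hR y hy]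
    calc lam * ‖P (x - y)‖ ≤ lam * (2 * R + 1) := by gcongr; linarith
      _ = r := by rw [hlam]; field_simp
  have h3 := hmove _ h1 _ (L.smul_mem lam (hPL (x - y)))
  convert h3 using 1
  rw [add_assoc, ← smul_add, add_sub_cancel]

/-- A nonempty open convex set in which all reflections in points of the set can be rescaled, by a
uniform factor, to stay inside is the whole space. -/
lemma eq_univ_of_reflection_mem {n : ℕ} {Ω : Set (Fin n → ℝ)} (hne : Ω.Nonempty) (ho : IsOpen Ω)
    (hc : Convex ℝ Ω) {lam : ℝ} (hlam : 0 < lam)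
    (h : ∀ x ∈ Ω, ∀ y ∈ Ω, x + lam • (x - y) ∈ Ω) : Ω = univ := by
  refine IsClopen.eq_univ ⟨?_, ho⟩ hne
  obtain ⟨y, hy⟩ := hne
  refine isClosed_of_closure_subset fun b hb => ?_
  have h1 : b + lam • (b - y) ∈ closure Ω := by
    have hcont : Continuous fun x : Fin n → ℝ => x + lam • (x - y) := by fun_prop
    exact map_mem_closure (f := fun x => x + lam • (x - y)) hcont hb fun x hx => h x hx y hy
  have h2 := hc.openSegment_interior_closure_subset_interior
    (by rwa [ho.interior_eq]) h1
    (show b ∈ openSegment ℝ y (b + lam • (b - y)) from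
      ⟨lam / (1 + lam), 1 / (1 + lam), by positivity, by positivity, by field_simp; ring, by
        ext i
        simp only [Pi.add_apply, Pi.smul_apply, Pi.sub_apply, smul_eq_mul]
        field_simp
        ring⟩)
  exact interior_subset h2

/-- The gauge of a set seen from the point `x`: the reciprocal of the time at which the ray from `x`
in the direction `w` leaves `Ω`. -/
def exitGauge {n : ℕ} (Ω : Set (Fin n → ℝ)) (x w : Fin n → ℝ) : ℝ :=
  gauge {z | x + z ∈ Ω} w

lemma isOpen_setOf_add_mem {n : ℕ} {Ω : Set (Fin n → ℝ)} (ho : IsOpen Ω) (x : Fin n → ℝ) :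
    IsOpen {z | x + z ∈ Ω} :=
  ho.preimage (by fun_prop : Continuous fun z => x + z)

lemma convex_setOf_add_mem {n : ℕ} {Ω : Set (Fin n → ℝ)} (hc : Convex ℝ Ω) (x : Fin n → ℝ) :
    Convex ℝ {z | x + z ∈ Ω} :=
  hc.translate_preimage_right x

lemma setOf_add_mem_mem_nhds {n : ℕ} {Ω : Set (Fin n → ℝ)} (ho : IsOpen Ω) {x : Fin n → ℝ}
    (hx : x ∈ Ω) : {z | x + z ∈ Ω} ∈ 𝓝 (0 : Fin n → ℝ) :=
  (isOpen_setOf_add_mem ho x).mem_nhds (by simpa using hx)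

lemma exitGauge_nonneg {n : ℕ} (Ω : Set (Fin n → ℝ)) (x w : Fin n → ℝ) : 0 ≤ exitGauge Ω x w :=
  gauge_nonneg w

lemma exitGauge_le_add {n : ℕ} {Ω : Set (Fin n → ℝ)} (ho : IsOpen Ω) (hc : Convex ℝ Ω)
    {x x' w w' : Fin n → ℝ} (hx : x ∈ Ω) {r : ℝ} (hr : 0 < r)
    (hball : Metric.closedBall x' r ⊆ Ω) :
    exitGauge Ω x' w' ≤ exitGauge Ω x w + (exitGauge Ω x w * ‖x' - x‖ + ‖w' - w‖) / r := by
  have hcont : Continuous fun s : ℝ => s + (s * ‖x' - x‖ + ‖w' - w‖) / r := by fun_prop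
  refine ge_of_tendsto ((hcont.tendsto _).mono_left
    (nhdsWithin_le_nhds (s := Ioi (exitGauge Ω x w)))) ?_
  filter_upwards [self_mem_nhdsWithin] with s hs
  obtain ⟨b, hb, hbs, z, hz, hzw⟩ := exists_lt_of_gauge_lt
    (absorbent_nhds_zero (setOf_add_mem_mem_nhds ho hx)) hs
  have hz : x + z ∈ Ω := hz
  have hzw : b • z = w := hzw
  set e : Fin n → ℝ := (x' - x) + b⁻¹ • (w' - w) with he
  set d : ℝ := ‖x' - x‖ + b⁻¹ * ‖w' - w‖ with hd
  have hd0 : 0 ≤ d := by positivity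
  have hed : ‖e‖ ≤ d := by
    refine (norm_add_le _ _).trans ?_
    rw [norm_smul, Real.norm_of_nonneg (by positivity : 0 ≤ b⁻¹)]
  have hy : x' + (r / d) • e ∈ Ω := by
    apply hball
    rw [mem_closedBall_iff_norm, add_sub_cancel_left, norm_smul,
      Real.norm_of_nonneg (by positivity)]
    calc r / d * ‖e‖ ≤ r / d * d := by gcongr
      _ ≤ r := by
        rcases hd0.eq_or_lt with h | h
        · simpa [← h] using hr.le
        · exact (div_mul_cancel₀ r h.ne').le
  have hkey : x' + (b * (1 + d / r))⁻¹ • w' ∈ Ω := by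
    have h1 := hc hz hy (a := r / (r + d)) (b := d / (r + d)) (by positivity) (by positivity)
      (by field_simp)
    have h2 : (d / (r + d)) • (r / d) • e = (r / (r + d)) • e := by
      rcases hd0.eq_or_lt with h | h
      · have : e = 0 := norm_le_zero_iff.1 (h ▸ hed)
        simp [this]
      · rw [smul_smul]
        congr 1
        field_simp
    rw [smul_add (d / (r + d)), h2, he] at h1
    convert h1 using 1
    rw [← hzw]
    ext i
    simp only [Pi.add_apply, Pi.smul_apply, Pi.sub_apply, smul_eq_mul]
    field_simp
    ring
  have hle : exitGauge Ω x' w' ≤ b * (1 + d / r) := by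
    refine gauge_le_of_mem (by positivity) ⟨_, hkey, ?_⟩
    exact smul_inv_smul₀ (by positivity) w'
  calc exitGauge Ω x' w' ≤ b * (1 + d / r) := hle
    _ = b + (b * ‖x' - x‖ + ‖w' - w‖) / r := by rw [hd]; field_simp
    _ ≤ s + (s * ‖x' - x‖ + ‖w' - w‖) / r := by gcongr

lemma exitGauge_le_norm_div {n : ℕ} {Ω : Set (Fin n → ℝ)} (ho : IsOpen Ω) (hc : Convex ℝ Ω)
    {x w : Fin n → ℝ} {r : ℝ} (hr : 0 < r) (hball : Metric.closedBall x r ⊆ Ω) :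
    exitGauge Ω x w ≤ ‖w‖ / r := by
  have h := exitGauge_le_add ho hc (w := 0) (w' := w)
    (hball (Metric.mem_closedBall_self hr.le)) hr hball
  simpa [exitGauge] using h

lemma exitGauge_pos {n : ℕ} {Ω : Set (Fin n → ℝ)} (ho : IsOpen Ω) (hc : Convex ℝ Ω)
    {x w : Fin n → ℝ} (hx : x ∈ Ω) (hw : w ∉ asympCone n Ω) : 0 < exitGauge Ω x w := by
  refine (exitGauge_nonneg Ω x w).lt_of_ne fun h0 => hw ?_
  refine mem_asympCone_of_ray ho hc (x := x) fun t ht => ?_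
  rcases ht.eq_or_lt with rfl | ht
  · simpa using hx
  have h1 : gauge {z | x + z ∈ Ω} (t • w) < 1 := by
    rw [gauge_smul_of_nonneg ht.le]
    have : gauge {z | x + z ∈ Ω} w = 0 := h0.symm
    simp [this]
  exact setOfPred_gauge_lt_one_subset_self (convex_setOf_add_mem hc x)
    (mem_of_mem_nhds (setOf_add_mem_mem_nhds ho hx))
    (absorbent_nhds_zero (setOf_add_mem_mem_nhds ho hx)) h1

/-- The point at which a ray leaves an open convex set. -/
lemma exit_mem_frontier {n : ℕ} {Ω : Set (Fin n → ℝ)} (ho : IsOpen Ω) (hc : Convex ℝ Ω)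
    {x w : Fin n → ℝ} (hx : x ∈ Ω) (hw : w ∉ asympCone n Ω) :
    x + (exitGauge Ω x w)⁻¹ • w ∈ closure Ω ∧ x + (exitGauge Ω x w)⁻¹ • w ∉ Ω := by
  have hpos := exitGauge_pos ho hc hx hw
  have h1 : gauge {z | x + z ∈ Ω} ((exitGauge Ω x w)⁻¹ • w) = 1 := by
    rw [gauge_smul_of_nonneg (inv_nonneg.2 hpos.le), smul_eq_mul]
    exact inv_mul_cancel₀ hpos.ne'
  constructor
  · have h2 := (gauge_le_one_iff_mem_closure (convex_setOf_add_mem hc x)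
      (setOf_add_mem_mem_nhds ho hx)).1 h1.le
    exact map_mem_closure (f := fun z => x + z) (by fun_prop) h2 fun z hz => hz
  · intro hmem
    exact (gauge_lt_one_of_mem_of_isOpen (isOpen_setOf_add_mem ho x) hmem).ne h1

lemma exitGauge_equivariant {n : ℕ} {Ω : Set (Fin n → ℝ)} (a : (Fin n → ℝ) ≃ᵃ[ℝ] (Fin n → ℝ))
    (ha : ∀ x, a x ∈ Ω ↔ x ∈ Ω) (x w : Fin n → ℝ) :
    exitGauge Ω (a x) (a.linear w) = exitGauge Ω x w := by
  unfold exitGauge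
  rw [gauge_def', gauge_def']
  congr 1
  ext r
  refine and_congr_right fun _ => ?_
  have h : a x + r⁻¹ • a.linear w = a (x + r⁻¹ • w) := by
    have := a.map_vadd x (r⁻¹ • w)
    simp only [vadd_eq_add, map_smul] at this
    rw [add_comm x, this, add_comm]
  change a x + r⁻¹ • a.linear w ∈ Ω ↔ x + r⁻¹ • w ∈ Ω
  rw [h, ha]

lemma locallyLipschitzOn_exitGauge {n : ℕ} {Ω : Set (Fin n → ℝ)} (ho : IsOpen Ω)
    (hc : Convex ℝ Ω) {u : (Fin n → ℝ) → (Fin n → ℝ)} (hu : LocallyLipschitzOn Ω u) :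
    LocallyLipschitzOn Ω fun x => exitGauge Ω x (u x) := by
  intro x₀ hx₀
  obtain ⟨C, t, ht, hCt⟩ := hu hx₀
  obtain ⟨R, hR, hRΩ⟩ := Metric.isOpen_iff.1 ho x₀ hx₀
  rw [ho.nhdsWithin_eq hx₀] at ht ⊢
  have hbd : ∀ᶠ x in 𝓝 x₀, ‖u x‖ < ‖u x₀‖ + 1 :=
    (hu.continuousOn.continuousAt (ho.mem_nhds hx₀)).norm.eventually_lt_const (lt_add_one _)
  set r := R / 3 with hr
  have hrpos : 0 < r := by positivity
  set M := ‖u x₀‖ + 1 with hM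
  have hM0 : 0 ≤ M := by positivity
  refine ⟨Real.toNNReal ((M / r + C) / r), t ∩ ({x | ‖u x‖ < M} ∩ Metric.ball x₀ r),
    inter_mem ht (inter_mem hbd (Metric.ball_mem_nhds _ hrpos)), ?_⟩
  have hball : ∀ x ∈ Metric.ball x₀ r, Metric.closedBall x r ⊆ Ω := by
    intro x hx y hy
    apply hRΩ
    rw [Metric.mem_ball] at hx ⊢
    rw [Metric.mem_closedBall] at hy
    linarith [dist_triangle y x x₀]
  have hone : ∀ x ∈ t ∩ ({x | ‖u x‖ < M} ∩ Metric.ball x₀ r),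
      ∀ y ∈ t ∩ ({x | ‖u x‖ < M} ∩ Metric.ball x₀ r),
      exitGauge Ω x (u x) - exitGauge Ω y (u y) ≤ (M / r + C) / r * dist x y := by
    intro x hx y hy
    have hyΩ : y ∈ Ω := hball y hy.2.2 (Metric.mem_closedBall_self hrpos.le)
    have h1 := exitGauge_le_add ho hc (w := u y) (w' := u x) hyΩ hrpos (hball x hx.2.2)
    have h2 : exitGauge Ω y (u y) ≤ M / r :=
      (exitGauge_le_norm_div ho hc hrpos (hball y hy.2.2)).trans
        (by have : ‖u y‖ < M := hy.2.1
            gcongr)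
    have h3 : ‖u x - u y‖ ≤ C * dist x y := by
      rw [← dist_eq_norm]
      exact hCt.dist_le_mul x hx.1 y hy.1
    have h4 : (exitGauge Ω y (u y) * ‖x - y‖ + ‖u x - u y‖) / r
        ≤ (M / r * dist x y + C * dist x y) / r := by
      rw [← dist_eq_norm x y]
      gcongr
    calc _ ≤ (M / r * dist x y + C * dist x y) / r := by linarith
      _ = _ := by ring
  refine LipschitzOnWith.of_dist_le_mul fun x hx y hy => ?_
  rw [Real.coe_toNNReal _ (by positivity), Real.dist_eq, abs_le]
  have h1 := hone x hx y hy
  have h2 := hone y hy x hx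
  rw [dist_comm y x] at h2
  constructor <;> linarith

lemma LocallyLipschitzOn.inv_smul_of_ne_zero {n : ℕ} {Ω : Set (Fin n → ℝ)}
    {g : (Fin n → ℝ) → ℝ} {u : (Fin n → ℝ) → (Fin n → ℝ)} (hg : LocallyLipschitzOn Ω g)
    (hu : LocallyLipschitzOn Ω u) (h0 : ∀ x ∈ Ω, g x ≠ 0) :
    LocallyLipschitzOn Ω fun x => (g x)⁻¹ • u x := by
  intro x hx
  have hq : ContDiffAt ℝ 1 (fun p : ℝ × (Fin n → ℝ) => p.1⁻¹ • p.2) (g x, u x) :=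
    (contDiffAt_fst.inv (h0 x hx)).smul contDiffAt_snd
  obtain ⟨K, t, ht, hKt⟩ := hq.exists_lipschitzOnWith
  obtain ⟨Cg, tg, htg, hCg⟩ := hg hx
  obtain ⟨Cu, tu, htu, hCu⟩ := hu hx
  have hpre : (fun y => (g y, u y)) ⁻¹' t ∈ 𝓝[Ω] x :=
    ((hg.continuousOn x hx).prodMk (hu.continuousOn x hx)) ht
  refine ⟨K * max Cg Cu, (tg ∩ tu) ∩ (fun y => (g y, u y)) ⁻¹' t,
    inter_mem (inter_mem htg htu) hpre, ?_⟩
  have h1 : LipschitzOnWith (max Cg Cu) (fun y => (g y, u y))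
      ((tg ∩ tu) ∩ (fun y => (g y, u y)) ⁻¹' t) :=
    (hCg.mono fun y hy => hy.1.1).prodMk (hCu.mono fun y hy => hy.1.2)
  exact hKt.comp h1 fun y hy => hy.2

/-- A map with values in the closure of a convex open set that takes a boundary value at a point
has singular derivative there. -/
lemma det_eq_zero_of_boundary_value {n : ℕ} {Ω : Set (Fin n → ℝ)} (ho : IsOpen Ω)
    (hne : Ω.Nonempty)
    (hc : Convex ℝ Ω) {F : (Fin n → ℝ) → (Fin n → ℝ)} {x : Fin n → ℝ} (hx : x ∈ Ω)
    {F' : (Fin n → ℝ) →L[ℝ] (Fin n → ℝ)} (hF' : HasFDerivAt F F' x)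
    (hF : ∀ y ∈ Ω, F y ∈ closure Ω) (hFx : F x ∉ Ω) : F'.det = 0 := by
  obtain ⟨l, hl⟩ := geometric_hahn_banach_open_point hc ho hFx
  have hlc : ∀ z ∈ closure Ω, l z ≤ l (F x) := by
    intro z hz
    exact closure_minimal (fun a ha => (hl a ha).le)
      (isClosed_le l.continuous continuous_const) hz
  have hmax : IsLocalMax (fun y => l (F y)) x := by
    filter_upwards [ho.mem_nhds hx] with y hy using hlc _ (hF y hy)
  have hzero : l.comp F' = 0 := hmax.hasFDerivAt_eq_zero (l.hasFDerivAt.comp x hF')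
  by_contra hdet
  obtain ⟨a, ha⟩ := hne
  have hsurj : Function.Surjective F' := by
    have hu : IsUnit (LinearMap.det (F' : (Fin n → ℝ) →ₗ[ℝ] (Fin n → ℝ))) :=
      isUnit_iff_ne_zero.2 hdet
    exact (LinearMap.equivOfDetNeZero _ hdet).surjective
  obtain ⟨v, hv⟩ := hsurj (a - F x)
  have h1 : l (F' v) = 0 := by
    have := congrArg (fun m => m v) hzero
    simpa using this
  rw [hv, map_sub] at h1
  linarith [hl a ha]

/-- A properly discontinuous, cocompact and volume preserving affine action of a group on an open
subset of `ℝⁿ`. -/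
structure IsUnimodularCocompactAction {n : ℕ} (Ω : Set (Fin n → ℝ)) {G : Type*} [Group G]
    (ρ : G →* ((Fin n → ℝ) ≃ᵃ[ℝ] (Fin n → ℝ))) : Prop where
  isOpen : IsOpen Ω
  nonempty : Ω.Nonempty
  mem_iff : ∀ γ x, ρ γ x ∈ Ω ↔ x ∈ Ω
  finite : ∀ K ⊆ Ω, IsCompact K → {γ | (ρ γ '' K ∩ K).Nonempty}.Finite
  cocompact : ∃ K ⊆ Ω, IsCompact K ∧ ∀ x ∈ Ω, ∃ γ, ρ γ x ∈ K
  det_linear : ∀ γ, LinearMap.det ((ρ γ).linear : (Fin n → ℝ) →ₗ[ℝ] (Fin n → ℝ)) = 1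

section action

variable {n : ℕ} {G : Type*} [Group G] (ρ : G →* ((Fin n → ℝ) ≃ᵃ[ℝ] (Fin n → ℝ)))

lemma affineAction_mul_apply (γ δ : G) (x : Fin n → ℝ) : ρ (γ * δ) x = ρ γ (ρ δ x) := by
  rw [map_mul]; rfl

lemma affineAction_inv_apply_apply (γ : G) (x : Fin n → ℝ) : ρ γ⁻¹ (ρ γ x) = x := by
  rw [← affineAction_mul_apply]; simp

lemma affineAction_apply_inv_apply (γ : G) (x : Fin n → ℝ) : ρ γ (ρ γ⁻¹ x) = x := by
  rw [← affineAction_mul_apply]; simp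

lemma affineAction_linear_mul_apply (γ δ : G) (x : Fin n → ℝ) :
    (ρ (γ * δ)).linear x = (ρ γ).linear ((ρ δ).linear x) := by
  rw [map_mul]; rfl

lemma affineAction_linear_inv_apply_apply (γ : G) (x : Fin n → ℝ) :
    (ρ γ⁻¹).linear ((ρ γ).linear x) = x := by
  rw [← affineAction_linear_mul_apply, inv_mul_cancel, map_one]; rfl

lemma affineAction_add (γ : G) (x v : Fin n → ℝ) : ρ γ (x + v) = ρ γ x + (ρ γ).linear v := by
  have := (ρ γ).map_vadd x v
  simp only [vadd_eq_add] at this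
  rw [add_comm, this, add_comm]

lemma continuous_affineAction (γ : G) : Continuous (ρ γ) :=
  (ρ γ).continuous_of_finiteDimensional

lemma exists_lipschitzWith_affineAction (γ : G) : ∃ C, LipschitzWith C (ρ γ) := by
  let A : (Fin n → ℝ) →L[ℝ] (Fin n → ℝ) :=
    LinearMap.toContinuousLinearMap ((ρ γ).linear : (Fin n → ℝ) →ₗ[ℝ] (Fin n → ℝ))
  refine ⟨‖A‖₊, LipschitzWith.of_dist_le_mul fun x y => ?_⟩
  have h : ρ γ x = ρ γ y + A (x - y) := by
    rw [show x = y + (x - y) by abel, affineAction_add]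
    simp [A]
  rw [h, dist_eq_norm, add_sub_cancel_left, dist_eq_norm]
  exact A.le_opNorm _

end action

namespace IsUnimodularCocompactAction

variable {n : ℕ} {Ω : Set (Fin n → ℝ)} {G : Type*} [Group G]
  {ρ : G →* ((Fin n → ℝ) ≃ᵃ[ℝ] (Fin n → ℝ))}

lemma finite_pair (h : IsUnimodularCocompactAction Ω ρ) {K L : Set (Fin n → ℝ)} (hK : K ⊆ Ω)
    (hKc : IsCompact K) (hL : L ⊆ Ω) (hLc : IsCompact L) :
    {γ | ∃ x ∈ K, ρ γ x ∈ L}.Finite := by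
  refine (h.finite (K ∪ L) (union_subset hK hL) (hKc.union hLc)).subset ?_
  rintro γ ⟨x, hx, hx'⟩
  exact ⟨ρ γ x, ⟨x, Or.inl hx, rfl⟩, Or.inr hx'⟩

lemma countable (h : IsUnimodularCocompactAction Ω ρ) : Countable G := by
  obtain ⟨x, hx⟩ := h.nonempty
  have : LocallyCompactSpace Ω := h.isOpen.locallyCompactSpace
  have : SigmaCompactSpace Ω := inferInstance
  have hsub : ∀ k, (Subtype.val '' compactCovering Ω k : Set (Fin n → ℝ)) ⊆ Ω := by
    rintro k _ ⟨y, -, rfl⟩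
    exact y.2
  have hfin : ∀ k, {γ | ∃ y ∈ ({x} : Set (Fin n → ℝ)),
      ρ γ y ∈ (Subtype.val '' compactCovering Ω k : Set (Fin n → ℝ))}.Finite := fun k =>
    h.finite_pair (singleton_subset_iff.2 hx) isCompact_singleton (hsub k)
      ((isCompact_compactCovering Ω k).image continuous_subtype_val)
  have huniv : (univ : Set G) ⊆ ⋃ k, {γ | ∃ y ∈ ({x} : Set (Fin n → ℝ)),
      ρ γ y ∈ (Subtype.val '' compactCovering Ω k : Set (Fin n → ℝ))} := by
    intro γ _
    obtain ⟨k, hk⟩ := exists_mem_compactCovering (⟨ρ γ x, (h.mem_iff γ x).2 hx⟩ : Ω)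
    exact mem_iUnion.2 ⟨k, x, rfl, _, hk, rfl⟩
  exact countable_univ_iff.1 ((countable_iUnion fun k => (hfin k).countable).mono huniv)

/-- A Lipschitz bump function whose translates cover the domain. -/
lemma exists_bump (h : IsUnimodularCocompactAction Ω ρ) :
    ∃ (χ : (Fin n → ℝ) → ℝ) (K : Set (Fin n → ℝ)), LipschitzWith 1 χ ∧ (∀ x, 0 ≤ χ x) ∧
      IsCompact K ∧ K ⊆ Ω ∧ (∀ x ∉ K, χ x = 0) ∧ ∀ x ∈ Ω, ∃ γ, 0 < χ (ρ γ x) := by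
  obtain ⟨K, hKΩ, hK, hcov⟩ := h.cocompact
  obtain ⟨r, hr, hrΩ⟩ := hK.exists_cthickening_subset_open h.isOpen hKΩ
  have hKne : K.Nonempty := by
    obtain ⟨x, hx⟩ := h.nonempty
    obtain ⟨γ, hγ⟩ := hcov x hx
    exact ⟨_, hγ⟩
  refine ⟨fun x => max (r - Metric.infDist x K) 0, Metric.cthickening r K, ?_,
    fun x => le_max_right _ _, hK.cthickening, hrΩ, ?_, ?_⟩
  · refine LipschitzWith.max_const (LipschitzWith.of_dist_le_mul fun x y => ?_) 0
    rw [dist_sub_left]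
    exact (Metric.lipschitz_infDist_pt K).dist_le_mul x y
  · intro x hx
    refine max_eq_right (sub_nonpos.2 ?_)
    by_contra! hlt
    obtain ⟨y, hy, hxy⟩ := (Metric.infDist_lt_iff hKne).1 hlt
    exact hx (Metric.mem_cthickening_of_dist_le x y r K hy hxy.le)
  · intro x hx
    obtain ⟨γ, hγ⟩ := hcov x hx
    refine ⟨γ, lt_max_of_lt_left ?_⟩
    rw [Metric.infDist_zero_of_mem hγ]
    linarith

lemma linear_mem_asympCone_iff (h : IsUnimodularCocompactAction Ω ρ) (γ : G) (u : Fin n → ℝ) :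
    (ρ γ).linear u ∈ asympCone n Ω ↔ u ∈ asympCone n Ω := by
  have key : ∀ (γ : G) (u : Fin n → ℝ), u ∈ asympCone n Ω → (ρ γ).linear u ∈ asympCone n Ω := by
    intro γ u hu x hx t ht
    have h1 := hu (ρ γ⁻¹ x) ((h.mem_iff _ _).2 hx) t ht
    have h2 := (h.mem_iff γ _).2 h1
    rwa [affineAction_add, affineAction_apply_inv_apply, map_smul] at h2
  refine ⟨fun hu => ?_, key γ u⟩
  simpa only [affineAction_linear_inv_apply_apply] using key γ⁻¹ _ hu

/-- An irreversible direction of recession can be averaged to an equivariant field of such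
directions. -/
lemma exists_equivariant_direction (h : IsUnimodularCocompactAction Ω ρ) {u₀ : Fin n → ℝ}
    (hu₀ : u₀ ∈ asympCone n Ω) (hu₀' : -u₀ ∉ asympCone n Ω) :
    ∃ u : (Fin n → ℝ) → (Fin n → ℝ), LocallyLipschitzOn Ω u ∧
      (∀ γ, ∀ x ∈ Ω, u (ρ γ x) = (ρ γ).linear (u x)) ∧
      ∀ x ∈ Ω, -u x ∉ asympCone n Ω := by
  obtain ⟨χ, K, hχ, hχ0, hK, hKΩ, hχK, hcov⟩ := h.exists_bump
  let f : G → (Fin n → ℝ) → (Fin n → ℝ) := fun γ x => χ (ρ γ x) • (ρ γ⁻¹).linear u₀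
  have hfin : ∀ C ⊆ Ω, IsCompact C → ∃ S : Finset G, ∀ x ∈ C,
      (Function.support fun γ => f γ x) ⊆ S := by
    intro C hC hCc
    refine ⟨(h.finite_pair hC hCc hKΩ hK).toFinset, fun x hx γ hγ => ?_⟩
    simp only [Finite.coe_toFinset]
    refine ⟨x, hx, ?_⟩
    by_contra hnot
    exact hγ (by simp [f, hχK _ hnot])
  have hflip : ∀ γ, ∃ C, LipschitzWith C (f γ) := by
    intro γ
    obtain ⟨C, hC⟩ := exists_lipschitzWith_affineAction ρ γ
    refine ⟨‖(ρ γ⁻¹).linear u₀‖₊ * (1 * C), LipschitzWith.of_dist_le_mul fun x y => ?_⟩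
    have h1 := (hχ.comp hC).dist_le_mul x y
    rw [dist_eq_norm, ← sub_smul, norm_smul, mul_comm, NNReal.coe_mul, mul_assoc]
    refine mul_le_mul_of_nonneg_left ?_ (norm_nonneg _)
    simpa [Real.dist_eq] using h1
  have hsumlip : ∀ S : Finset G, ∃ C, LipschitzWith C fun x => ∑ γ ∈ S, f γ x := by
    classical
    intro S
    induction S using Finset.induction_on with
    | empty => exact ⟨0, by simp⟩
    | insert a S ha ih =>
      obtain ⟨C₁, h₁⟩ := hflip a
      obtain ⟨C₂, h₂⟩ := ih
      refine ⟨C₁ + C₂, ?_⟩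
      simp_rw [Finset.sum_insert ha]
      exact h₁.add h₂
  refine ⟨fun x => ∑ᶠ γ, f γ x, ?_, ?_, ?_⟩
  · intro x hx
    obtain ⟨R, hR, hRΩ⟩ := Metric.nhds_basis_closedBall.mem_iff.1 (h.isOpen.mem_nhds hx)
    obtain ⟨S, hS⟩ := hfin _ hRΩ (isCompact_closedBall x R)
    obtain ⟨C, hC⟩ := hsumlip S
    refine ⟨C, Metric.closedBall x R,
      mem_nhdsWithin_of_mem_nhds (Metric.closedBall_mem_nhds x hR), ?_⟩
    intro y hy z hz
    simp only [finsum_eq_sum_of_support_subset _ (hS y hy),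
      finsum_eq_sum_of_support_subset _ (hS z hz)]
    exact hC y z
  · intro δ x hx
    change ∑ᶠ γ, f γ (ρ δ x) = (ρ δ).linear (∑ᶠ γ, f γ x)
    have h1 : (ρ δ).linear (∑ᶠ γ, f γ x) = ∑ᶠ γ, (ρ δ).linear (f γ x) :=
      ((ρ δ).linear.toAddEquiv).map_finsum _
    rw [h1, ← finsum_comp_equiv (Equiv.mulRight δ) (f := fun γ => (ρ δ).linear (f γ x))]
    refine finsum_congr fun γ => ?_
    simp only [f, Equiv.coe_mulRight, map_smul, affineAction_mul_apply, _root_.mul_inv_rev]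
    rw [← affineAction_linear_mul_apply, mul_inv_cancel_left]
  · intro x hx
    obtain ⟨S, hS⟩ := hfin {x} (singleton_subset_iff.2 hx) isCompact_singleton
    simp only [finsum_eq_sum_of_support_subset _ (hS x rfl)]
    obtain ⟨γ, hγ⟩ := hcov x hx
    have hneg : -f γ x ∉ asympCone n Ω := by
      intro hmem
      have h1 := asympCone_smul_mem hmem (inv_nonneg.2 hγ.le)
      rw [smul_neg, inv_smul_smul₀ hγ.ne', ← map_neg] at h1
      exact hu₀' ((h.linear_mem_asympCone_iff _ _).1 h1)
    refine neg_sum_notMem_asympCone S (fun γ => f γ x) (fun δ _ => ?_) (i := γ) ?_ hneg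
    · exact asympCone_smul_mem ((h.linear_mem_asympCone_iff _ _).2 hu₀) (hχ0 _)
    · apply hS x rfl
      intro h0
      have h0 : f γ x = 0 := h0
      rw [h0, neg_zero] at hneg
      exact hneg asympCone_zero_mem

end IsUnimodularCocompactAction

namespace IsUnimodularCocompactAction

variable {n : ℕ} {Ω : Set (Fin n → ℝ)} {G : Type*} [Group G]
  {ρ : G →* ((Fin n → ℝ) ≃ᵃ[ℝ] (Fin n → ℝ))} {X : (Fin n → ℝ) → (Fin n → ℝ)}

lemma add_smul_field_equivariant (hXρ : ∀ γ, ∀ x ∈ Ω, X (ρ γ x) = (ρ γ).linear (X x))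
    (γ : G) {x : Fin n → ℝ} (hx : x ∈ Ω) (t : ℝ) :
    ρ γ (x + t • X x) = ρ γ x + t • X (ρ γ x) := by
  rw [affineAction_add, map_smul, hXρ γ x hx]

/-- Moving the points of the domain for a short time along an equivariant locally Lipschitz field
permutes the domain. -/
lemma exists_bijOn_add_smul_field (h : IsUnimodularCocompactAction Ω ρ)
    (hX : LocallyLipschitzOn Ω X)
    (hXρ : ∀ γ, ∀ x ∈ Ω, X (ρ γ x) = (ρ γ).linear (X x)) :
    ∃ ε > 0, ∀ t : ℝ, 0 < t → t < ε → BijOn (fun x => x + t • X x) Ω Ω := by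
  obtain ⟨K, hKΩ, hK, hcov⟩ := h.cocompact
  obtain ⟨r, hr, hrΩ⟩ := hK.exists_cthickening_subset_open h.isOpen hKΩ
  set K1 := Metric.cthickening r K with hK1
  have hK1c : IsCompact K1 := hK.cthickening
  have hKK1 : K ⊆ K1 := Metric.self_subset_cthickening K
  obtain ⟨B, hB⟩ := (hK1c.image_of_continuousOn
    (hX.continuousOn.mono hrΩ)).isBounded.exists_norm_le
  have hB' : ∀ x ∈ K1, ‖X x‖ ≤ B := fun x hx => hB _ ⟨x, hx, rfl⟩
  have hB0 : 0 ≤ B := by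
    obtain ⟨x, hx⟩ := h.nonempty
    obtain ⟨γ, hγ⟩ := hcov x hx
    exact (norm_nonneg _).trans (hB' _ (hKK1 hγ))
  have hSfin := h.finite_pair hrΩ hK1c hrΩ hK1c
  set S := {γ | ∃ x ∈ K1, ρ γ x ∈ K1}
  set K3 := K1 ∪ ⋃ γ ∈ S, ρ γ⁻¹ '' K with hK3
  have hK3c : IsCompact K3 :=
    hK1c.union (hSfin.isCompact_biUnion fun γ _ => hK.image (continuous_affineAction ρ _))
  have hK3Ω : K3 ⊆ Ω := by
    refine union_subset hrΩ (iUnion₂_subset fun γ _ => ?_)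
    rintro _ ⟨x, hx, rfl⟩
    exact (h.mem_iff _ _).2 (hKΩ hx)
  obtain ⟨C, hC⟩ :=
    LocallyLipschitzOn.exists_lipschitzOnWith_of_compact hK3c (hX.mono hK3Ω)
  refine ⟨min (r / (B + 1)) (1 / (C + 1)), by positivity, fun t ht htε => ?_⟩
  have htB : t * B ≤ r := by
    have h1 := (lt_div_iff₀ (by positivity)).1 (htε.trans_le (min_le_left _ _))
    nlinarith
  have htC : t * C < 1 := by
    have h1 := (lt_div_iff₀ (by positivity)).1 (htε.trans_le (min_le_right _ _))
    nlinarith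
  have hstep : ∀ x ∈ K1, ‖t • X x‖ ≤ r := by
    intro x hx
    rw [norm_smul, Real.norm_of_nonneg ht.le]
    exact (mul_le_mul_of_nonneg_left (hB' x hx) ht.le).trans htB
  have hball : ∀ x ∈ K, Metric.closedBall x r ⊆ K1 := fun x hx y hy =>
    Metric.mem_cthickening_of_dist_le y x r K hx hy
  have hFK : ∀ x ∈ K, x + t • X x ∈ K1 := by
    intro x hx
    refine hball x hx ?_
    rw [Metric.mem_closedBall, dist_eq_norm, add_sub_cancel_left]
    exact hstep x (hKK1 hx)
  have hmaps : ∀ x ∈ Ω, x + t • X x ∈ Ω := by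
    intro x hx
    obtain ⟨γ, hγ⟩ := hcov x hx
    rw [← h.mem_iff γ, add_smul_field_equivariant hXρ γ hx]
    exact hrΩ (hFK _ hγ)
  have hlip : ∀ x ∈ K3, ∀ y ∈ K3, ‖t • X x - t • X y‖ ≤ t * C * ‖x - y‖ := by
    intro x hx y hy
    rw [← smul_sub, norm_smul, Real.norm_of_nonneg ht.le, mul_assoc]
    refine mul_le_mul_of_nonneg_left ?_ ht.le
    simpa [dist_eq_norm] using hC.dist_le_mul x hx y hy
  have hinjK : ∀ x ∈ K, ∀ y ∈ Ω, x + t • X x = y + t • X y → x = y := by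
    intro x hx y hy hxy
    obtain ⟨γ, hγ⟩ := hcov y hy
    have hγS : γ ∈ S := by
      refine ⟨_, hFK x hx, ?_⟩
      rw [hxy, add_smul_field_equivariant hXρ γ hy]
      exact hFK _ hγ
    have hyK3 : y ∈ K3 :=
      Or.inr (mem_iUnion₂.2 ⟨γ, hγS, _, hγ, affineAction_inv_apply_apply ρ γ y⟩)
    have h1 := hlip y hyK3 x (Or.inl (hKK1 hx))
    rw [show t • X y - t • X x = x - y by rw [sub_eq_sub_iff_add_eq_add, add_comm, hxy.symm,
      add_comm], ← norm_neg, neg_sub] at h1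
    by_contra hne
    have h2 : 0 < ‖y - x‖ := norm_pos_iff.2 (sub_ne_zero.2 (Ne.symm hne))
    nlinarith
  refine ⟨hmaps, fun x hx y hy hxy => ?_, fun y hy => ?_⟩
  · obtain ⟨γ, hγ⟩ := hcov x hx
    refine (ρ γ).injective (hinjK _ hγ _ ((h.mem_iff γ y).2 hy) ?_)
    rw [← add_smul_field_equivariant hXρ γ hx, ← add_smul_field_equivariant hXρ γ hy]
    exact congrArg (ρ γ) hxy
  · obtain ⟨γ, hγ⟩ := hcov y hy
    set z := ρ γ y with hz
    have hsub : Metric.closedBall z r ⊆ K3 := (hball z hγ).trans subset_union_left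
    have hmapsT : MapsTo (fun x => z - t • X x) (Metric.closedBall z r)
        (Metric.closedBall z r) := by
      intro x hx
      rw [Metric.mem_closedBall, dist_eq_norm, sub_sub_cancel_left, norm_neg]
      exact hstep x (hball z hγ hx)
    have hcontr : ContractingWith ⟨t * C, by positivity⟩ (hmapsT.restrict _ _ _) := by
      refine ⟨htC, LipschitzWith.of_dist_le_mul fun x y => ?_⟩
      rw [Subtype.dist_eq, Subtype.dist_eq, MapsTo.val_restrict_apply, MapsTo.val_restrict_apply,
        dist_sub_left, dist_eq_norm, dist_eq_norm]
      exact hlip _ (hsub x.2) _ (hsub y.2)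
    obtain ⟨w, hw, hfix, -⟩ := ContractingWith.exists_fixedPoint'
      (Metric.isClosed_closedBall.isComplete) hmapsT hcontr
      (Metric.mem_closedBall_self hr.le) (edist_ne_top _ _)
    have hwΩ : w ∈ Ω := hK3Ω (hsub hw)
    refine ⟨ρ γ⁻¹ w, (h.mem_iff _ _).2 hwΩ, ?_⟩
    change ρ γ⁻¹ w + t • X (ρ γ⁻¹ w) = y
    rw [← add_smul_field_equivariant hXρ _ hwΩ]
    have h1 : w + t • X w = z := by
      have : z - t • X w = w := hfix
      rw [eq_sub_iff_add_eq.1 this.symm]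
    rw [h1, hz, affineAction_inv_apply_apply]

end IsUnimodularCocompactAction

namespace IsUnimodularCocompactAction
open MeasureTheory

variable {n : ℕ} {Ω : Set (Fin n → ℝ)} {G : Type*} [Group G]
  {ρ : G →* ((Fin n → ℝ) ≃ᵃ[ℝ] (Fin n → ℝ))} {X : (Fin n → ℝ) → (Fin n → ℝ)}

lemma measurePreserving (h : IsUnimodularCocompactAction Ω ρ) (γ : G) :
    MeasurePreserving (ρ γ) volume volume := by
  have h1 : MeasurePreserving ((ρ γ).linear : (Fin n → ℝ) →ₗ[ℝ] (Fin n → ℝ)) volume volume := by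
    refine ⟨(LinearMap.continuous_of_finiteDimensional _).measurable, ?_⟩
    rw [Real.map_linearMap_volume_pi_eq_smul_volume_pi (by simp [h.det_linear γ]),
      h.det_linear γ]
    simp
  have h2 := (measurePreserving_add_left volume (ρ γ 0)).comp h1
  convert h2 using 1
  ext1 x
  have := affineAction_add ρ γ 0 x
  rw [zero_add] at this
  exact this

lemma lintegral_comp (h : IsUnimodularCocompactAction Ω ρ) {D : Set (Fin n → ℝ)}
    (hinv : ∀ γ x, ρ γ x ∈ D ↔ x ∈ D) (hD : MeasurableSet D) {f : (Fin n → ℝ) → ENNReal}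
    (hf : Measurable f) (γ : G) : ∫⁻ x in D, f (ρ γ x) = ∫⁻ x in D, f x := by
  have h1 := (h.measurePreserving γ).setLIntegral_comp_preimage hD hf
  rwa [show ρ γ ⁻¹' D = D from Set.ext fun x => hinv γ x] at h1

/-- The integral of an invariant weight over the quotient, computed with two partitions of unity. -/
lemma lintegral_mul_partition_eq (h : IsUnimodularCocompactAction Ω ρ) {D : Set (Fin n → ℝ)}
    (hinv : ∀ γ x, ρ γ x ∈ D ↔ x ∈ D) (hD : MeasurableSet D)
    {w ψ₁ ψ₂ : (Fin n → ℝ) → ENNReal} (hw : Measurable w) (h₁ : Measurable ψ₁)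
    (h₂ : Measurable ψ₂) (hwρ : ∀ γ, ∀ x ∈ D, w (ρ γ x) = w x)
    (hs₁ : ∀ x ∈ D, ∑' γ, ψ₁ (ρ γ x) = 1) (hs₂ : ∀ x ∈ D, ∑' γ, ψ₂ (ρ γ x) = 1) :
    ∫⁻ x in D, w x * ψ₁ x = ∫⁻ x in D, w x * ψ₂ x := by
  have := h.countable
  have hm : ∀ γ, Measurable (ρ γ) := fun γ => (continuous_affineAction ρ γ).measurable
  calc ∫⁻ x in D, w x * ψ₁ x
      = ∫⁻ x in D, ∑' γ, w x * ψ₁ x * ψ₂ (ρ γ x) := by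
        refine setLIntegral_congr_fun hD fun x hx => ?_
        rw [ENNReal.tsum_mul_left, hs₂ x hx, mul_one]
    _ = ∑' γ, ∫⁻ x in D, w x * ψ₁ x * ψ₂ (ρ γ x) :=
        lintegral_tsum fun γ => ((hw.mul h₁).mul (h₂.comp (hm γ))).aemeasurable
    _ = ∑' γ, ∫⁻ x in D, w x * ψ₂ x * ψ₁ (ρ γ⁻¹ x) := by
        refine tsum_congr fun γ => ?_
        refine Eq.trans ?_ (h.lintegral_comp hinv hD ((hw.mul h₂).mul (h₁.comp (hm γ⁻¹))) γ)
        refine setLIntegral_congr_fun hD fun x hx => ?_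
        simp only [Pi.mul_apply, Function.comp_apply]
        rw [hwρ γ x hx, affineAction_inv_apply_apply, mul_right_comm]
    _ = ∑' γ, ∫⁻ x in D, w x * ψ₂ x * ψ₁ (ρ γ x) :=
        (Equiv.inv G).tsum_eq fun γ => ∫⁻ x in D, w x * ψ₂ x * ψ₁ (ρ γ x)
    _ = ∫⁻ x in D, ∑' γ, w x * ψ₂ x * ψ₁ (ρ γ x) :=
        (lintegral_tsum fun γ => ((hw.mul h₂).mul (h₁.comp (hm γ))).aemeasurable).symm
    _ = ∫⁻ x in D, w x * ψ₂ x := by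
        refine setLIntegral_congr_fun hD fun x hx => ?_
        rw [ENNReal.tsum_mul_left, hs₁ x hx, mul_one]

/-- A measurable partition of unity with compact support. -/
lemma exists_partition (h : IsUnimodularCocompactAction Ω ρ) :
    ∃ (ψ : (Fin n → ℝ) → ENNReal) (K : Set (Fin n → ℝ)), Measurable ψ ∧ IsCompact K ∧ K ⊆ Ω ∧
      (∀ x ∉ K, ψ x = 0) ∧ ∀ x ∈ Ω, ∑' γ, ψ (ρ γ x) = 1 := by
  obtain ⟨χ, K, hχ, hχ0, hK, hKΩ, hχK, hcov⟩ := h.exists_bump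
  have := h.countable
  have hm : ∀ γ, Measurable (ρ γ) := fun γ => (continuous_affineAction ρ γ).measurable
  let f : (Fin n → ℝ) → ENNReal := fun x => ENNReal.ofReal (χ x)
  have hf : Measurable f := hχ.continuous.measurable.ennreal_ofReal
  let s : (Fin n → ℝ) → ENNReal := fun x => ∑' γ, f (ρ γ x)
  have hs : Measurable s := Measurable.tsum fun γ => hf.comp (hm γ)
  have hsρ : ∀ γ x, s (ρ γ x) = s x := by
    intro γ x
    simp only [s, ← affineAction_mul_apply]
    exact (Equiv.mulRight γ).tsum_eq (fun δ => f (ρ δ x))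
  refine ⟨fun x => f x / s x, K, hf.div hs, hK, hKΩ, fun x hx => by simp [f, hχK x hx], ?_⟩
  intro x hx
  simp only [hsρ, div_eq_mul_inv]
  rw [ENNReal.tsum_mul_right]
  refine ENNReal.mul_inv_cancel ?_ ?_
  · obtain ⟨γ, hγ⟩ := hcov x hx
    intro h0
    have := ENNReal.tsum_eq_zero.1 h0 γ
    simp only [f, ENNReal.ofReal_eq_zero] at this
    linarith
  · have hfin := h.finite_pair (singleton_subset_iff.2 hx) isCompact_singleton hKΩ hK
    have h1 : ∑' γ, f (ρ γ x) = ∑ γ ∈ hfin.toFinset, f (ρ γ x) := by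
      refine tsum_eq_sum fun γ hγ => ?_
      have : ρ γ x ∉ K := fun hmem => hγ (hfin.mem_toFinset.2 ⟨x, rfl, hmem⟩)
      simp [f, hχK _ this]
    rw [h1]
    exact ENNReal.sum_ne_top.2 fun γ _ => ENNReal.ofReal_ne_top

lemma hasFDerivAt_field (h : IsUnimodularCocompactAction Ω ρ)
    (hXρ : ∀ γ, ∀ x ∈ Ω, X (ρ γ x) = (ρ γ).linear (X x)) {x : Fin n → ℝ} (hx : x ∈ Ω)
    {X' : (Fin n → ℝ) →L[ℝ] (Fin n → ℝ)} (hX' : HasFDerivAt X X' x) (γ : G) :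
    HasFDerivAt X (((ρ γ).linear.toContinuousLinearEquiv : (Fin n → ℝ) →L[ℝ] (Fin n → ℝ)) ∘L
      X' ∘L ((ρ γ).linear.symm.toContinuousLinearEquiv : (Fin n → ℝ) →L[ℝ] (Fin n → ℝ)))
      (ρ γ x) := by
  have h1 : HasFDerivAt (ρ γ⁻¹)
      ((ρ γ).linear.symm.toContinuousLinearEquiv : (Fin n → ℝ) →L[ℝ] (Fin n → ℝ)) (ρ γ x) := by
    have h2 : ∀ y, ρ γ⁻¹ y = (ρ γ).linear.symm y + ρ γ⁻¹ 0 := by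
      intro y
      have h3 := affineAction_add ρ γ⁻¹ 0 y
      rw [zero_add] at h3
      rw [h3, add_comm]
      congr 1
      rw [LinearEquiv.eq_symm_apply]
      simpa using affineAction_linear_inv_apply_apply ρ γ⁻¹ y
    rw [funext h2]
    exact (((ρ γ).linear.symm.toContinuousLinearEquiv :
      (Fin n → ℝ) →L[ℝ] (Fin n → ℝ)).hasFDerivAt).add_const _
  have h3 : HasFDerivAt (fun y => (ρ γ).linear (X (ρ γ⁻¹ y)))
      (((ρ γ).linear.toContinuousLinearEquiv : (Fin n → ℝ) →L[ℝ] (Fin n → ℝ)) ∘L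
      X' ∘L ((ρ γ).linear.symm.toContinuousLinearEquiv : (Fin n → ℝ) →L[ℝ] (Fin n → ℝ)))
      (ρ γ x) := by
    have h4 : HasFDerivAt X X' (ρ γ⁻¹ (ρ γ x)) := by rwa [affineAction_inv_apply_apply]
    exact (((ρ γ).linear.toContinuousLinearEquiv :
      (Fin n → ℝ) →L[ℝ] (Fin n → ℝ)).hasFDerivAt).comp _ (h4.comp _ h1)
  refine h3.congr_of_eventuallyEq ?_
  filter_upwards [h.isOpen.mem_nhds ((h.mem_iff γ x).2 hx)] with y hy
  rw [← hXρ γ _ ((h.mem_iff _ _).2 hy), affineAction_apply_inv_apply]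

lemma det_one_add_smul_fderiv_field (h : IsUnimodularCocompactAction Ω ρ)
    (hXρ : ∀ γ, ∀ x ∈ Ω, X (ρ γ x) = (ρ γ).linear (X x)) {x : Fin n → ℝ} (hx : x ∈ Ω)
    (hX' : DifferentiableAt ℝ X x) (γ : G) (t : ℝ) :
    (1 + t • fderiv ℝ X (ρ γ x)).det = (1 + t • fderiv ℝ X x).det := by
  rw [(h.hasFDerivAt_field hXρ hx hX'.hasFDerivAt γ).fderiv, ContinuousLinearMap.det,
    ContinuousLinearMap.det, ← LinearMap.det_conj
      (1 + t • fderiv ℝ X x : (Fin n → ℝ) →L[ℝ] (Fin n → ℝ)) (ρ γ).linear]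
  congr 1
  refine LinearMap.ext fun v => ?_
  simp

/-- The points of the domain where the field is differentiable. -/
lemma mem_differentiable_iff (h : IsUnimodularCocompactAction Ω ρ)
    (hXρ : ∀ γ, ∀ x ∈ Ω, X (ρ γ x) = (ρ γ).linear (X x)) (γ : G) (x : Fin n → ℝ) :
    ρ γ x ∈ Ω ∩ {x | DifferentiableAt ℝ X x} ↔ x ∈ Ω ∩ {x | DifferentiableAt ℝ X x} := by
  have key : ∀ (γ : G) x, x ∈ Ω ∩ {x | DifferentiableAt ℝ X x} →
      ρ γ x ∈ Ω ∩ {x | DifferentiableAt ℝ X x} := fun γ x hx =>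
    ⟨(h.mem_iff γ x).2 hx.1, (h.hasFDerivAt_field hXρ hx.1 hx.2.hasFDerivAt γ).differentiableAt⟩
  refine ⟨fun hx => ?_, key γ x⟩
  simpa only [affineAction_inv_apply_apply] using key γ⁻¹ _ hx

end IsUnimodularCocompactAction

section null
open MeasureTheory

variable {n : ℕ} {Ω : Set (Fin n → ℝ)} {f : (Fin n → ℝ) → (Fin n → ℝ)}

lemma LocallyLipschitzOn.volume_not_differentiableAt_eq_zero (hf : LocallyLipschitzOn Ω f)
    (ho : IsOpen Ω) : volume (Ω \ {x | DifferentiableAt ℝ f x}) = 0 := by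
  refine measure_null_of_locally_null _ fun x hx => ?_
  obtain ⟨C, t, ht, hC⟩ := hf hx.1
  rw [ho.nhdsWithin_eq hx.1] at ht
  obtain ⟨U, hUt, hU, hxU⟩ := mem_nhds_iff.1 ht
  refine ⟨_ ∩ U, inter_mem_nhdsWithin _ (hU.mem_nhds hxU), ?_⟩
  have h1 := (hC.mono hUt).ae_differentiableWithinAt_of_mem (μ := volume)
  refine measure_mono_null ?_ h1
  rintro y ⟨⟨-, hy⟩, hyU⟩
  simp only [mem_compl_iff, mem_ofPred_eq, not_forall]
  exact ⟨hyU, fun hd => hy (hd.differentiableAt (hU.mem_nhds hyU))⟩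

lemma LocallyLipschitzOn.volume_image_eq_zero (hf : LocallyLipschitzOn Ω f)
    {N : Set (Fin n → ℝ)} (hN : N ⊆ Ω) (h0 : volume N = 0) : volume (f '' N) = 0 := by
  have hf' : ∀ x ∈ Ω, ∃ (C : NNReal) (u : Set (Fin n → ℝ)), u ∈ 𝓝[Ω] x ∧ LipschitzOnWith C f u :=
    fun x hx => hf hx
  choose! C t ht hC using hf'
  obtain ⟨s, hsN, hs, hcov⟩ := TopologicalSpace.countable_cover_nhdsWithin
    fun x hx => nhdsWithin_mono x hN (ht x (hN hx))
  have h1 : f '' N ⊆ ⋃ x ∈ s, f '' (N ∩ t x) := by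
    rintro _ ⟨y, hy, rfl⟩
    obtain ⟨x, hx, hyx⟩ := mem_iUnion₂.1 (hcov hy)
    exact mem_iUnion₂.2 ⟨x, hx, y, ⟨hy, hyx⟩, rfl⟩
  refine measure_mono_null h1 ((measure_biUnion_null_iff hs).2 fun x hx => ?_)
  have h2 := ((hC x (hN (hsN hx))).mono (inter_subset_right (s := N))).hausdorffMeasure_image_le
    (d := Fintype.card (Fin n)) (Nat.cast_nonneg _)
  rw [hausdorffMeasure_pi_real] at h2
  have h3 : volume (N ∩ t x) = 0 := measure_mono_null inter_subset_left h0
  rw [h3, mul_zero] at h2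
  exact le_antisymm h2 zero_le

lemma LocallyLipschitzOn.id_add_smul (hf : LocallyLipschitzOn Ω f) (t : ℝ) :
    LocallyLipschitzOn Ω fun x => x + t • f x := by
  intro x hx
  obtain ⟨C, s, hs, hC⟩ := hf hx
  refine ⟨1 + ‖t‖₊ * C, s, hs, ?_⟩
  refine LipschitzOnWith.of_dist_le_mul fun y hy z hz => ?_
  refine (dist_add_add_le _ _ _ _).trans ?_
  rw [dist_smul₀, NNReal.coe_add, NNReal.coe_mul, add_mul, NNReal.coe_one, one_mul, mul_assoc]
  gcongr
  · exact le_of_eq rfl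
  · exact hC.dist_le_mul y hy z hz

end null

namespace IsUnimodularCocompactAction
open MeasureTheory

variable {n : ℕ} {Ω : Set (Fin n → ℝ)} {G : Type*} [Group G]
  {ρ : G →* ((Fin n → ℝ) ≃ᵃ[ℝ] (Fin n → ℝ))} {X : (Fin n → ℝ) → (Fin n → ℝ)}

/-- If `x ↦ x + t X(x)` permutes the domain, then its Jacobian has average one. -/
lemma lintegral_det_mul_partition (h : IsUnimodularCocompactAction Ω ρ)
    (hX : LocallyLipschitzOn Ω X) (hXm : Measurable X)
    (hXρ : ∀ γ, ∀ x ∈ Ω, X (ρ γ x) = (ρ γ).linear (X x)) {t : ℝ}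
    (ht : BijOn (fun x => x + t • X x) Ω Ω) {ψ : (Fin n → ℝ) → ENNReal} (hψ : Measurable ψ)
    (hψρ : ∀ x ∈ Ω, ∑' γ, ψ (ρ γ x) = 1) :
    ∫⁻ x in Ω ∩ {x | DifferentiableAt ℝ X x},
      ENNReal.ofReal |(1 + t • fderiv ℝ X x).det| * ψ x =
    ∫⁻ x in Ω ∩ {x | DifferentiableAt ℝ X x}, ψ x := by
  set D := Ω ∩ {x | DifferentiableAt ℝ X x} with hDdef
  set F : (Fin n → ℝ) → (Fin n → ℝ) := fun x => x + t • X x with hF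
  have hD : MeasurableSet D := h.isOpen.measurableSet.inter (measurableSet_of_differentiableAt ℝ X)
  have hw : Measurable fun x => ENNReal.ofReal |(1 + t • fderiv ℝ X x).det| := by
    have h1 : Continuous fun A : (Fin n → ℝ) →L[ℝ] (Fin n → ℝ) =>
        ENNReal.ofReal |(1 + t • A).det| :=
      ENNReal.continuous_ofReal.comp (continuous_abs.comp
        (ContinuousLinearMap.continuous_det.comp (by fun_prop)))
    exact h1.measurable.comp (measurable_fderiv ℝ X)
  have hFm : Measurable F := measurable_id.add (hXm.const_smul t)
  have h1 := h.lintegral_mul_partition_eq (h.mem_differentiable_iff hXρ) hD hw hψ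
    (hψ.comp hFm) (fun γ x hx => by rw [h.det_one_add_smul_fderiv_field hXρ hx.1 hx.2])
    (fun x hx => hψρ x hx.1) (fun x hx => by
      rw [← hψρ (F x) (ht.mapsTo hx.1)]
      refine tsum_congr fun γ => ?_
      simp only [Function.comp_apply, hF]
      rw [add_smul_field_equivariant hXρ γ hx.1])
  rw [h1]
  have h2 := lintegral_image_eq_lintegral_abs_det_fderiv_mul volume hD
    (f := F) (f' := fun x => 1 + t • fderiv ℝ X x) (fun x hx => by
      have := (hasFDerivAt_id x).add (hx.2.hasFDerivAt.const_smul t)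
      exact this.hasFDerivWithinAt) (ht.injOn.mono inter_subset_left) ψ
  refine h2.symm.trans (setLIntegral_congr ?_)
  have hnull := hX.volume_not_differentiableAt_eq_zero h.isOpen
  have hΩD : Ω \ D = Ω \ {x | DifferentiableAt ℝ X x} := sdiff_self_inter
  have h3 : D =ᵐ[volume] Ω :=
    (ae_eq_set.2 ⟨by rw [sdiff_eq_empty.2 inter_subset_left, measure_empty], by rwa [hΩD]⟩)
  refine EventuallyEq.trans (ae_eq_set.2 ⟨?_, ?_⟩) h3.symm
  · rw [sdiff_eq_empty.2, measure_empty]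
    exact (image_mono inter_subset_left).trans ht.image_eq.subset
  · refine measure_mono_null ?_ ((hX.id_add_smul t).volume_image_eq_zero sdiff_subset hnull)
    rintro y ⟨hy, hyD⟩
    obtain ⟨x, hx, rfl⟩ := ht.surjOn hy
    exact ⟨x, ⟨hx, fun hxd => hyD ⟨x, ⟨hx, hxd⟩, rfl⟩⟩, rfl⟩

end IsUnimodularCocompactAction

section extrapolate
open MeasureTheory

variable {n : ℕ}

lemma exists_polynomial_det_one_add_smul (A : (Fin n → ℝ) →L[ℝ] (Fin n → ℝ)) :
    ∃ p : Polynomial ℝ, p.natDegree ≤ n ∧ ∀ t : ℝ, p.eval t = (1 + t • A).det := by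
  let M := LinearMap.toMatrix' (A : (Fin n → ℝ) →ₗ[ℝ] (Fin n → ℝ))
  refine ⟨((Polynomial.X : Polynomial ℝ) • M.map Polynomial.C + (1 : Matrix (Fin n) (Fin n) ℝ).map
    Polynomial.C).det, ?_, fun t => ?_⟩
  · simpa using Polynomial.natDegree_det_X_add_C_le M 1
  · rw [← Polynomial.coe_evalRingHom, RingHom.map_det, ContinuousLinearMap.det,
      ← LinearMap.det_toMatrix']
    congr 1
    have h1 : LinearMap.toMatrix' ((1 + t • A : (Fin n → ℝ) →L[ℝ] (Fin n → ℝ)) :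
        (Fin n → ℝ) →ₗ[ℝ] (Fin n → ℝ)) = 1 + t • M := by
      rw [ContinuousLinearMap.toLinearMap_add, ContinuousLinearMap.toLinearMap_smul, map_add,
        map_smul, ContinuousLinearMap.toLinearMap_one, LinearMap.toMatrix'_one]
    rw [h1]
    ext i j
    by_cases hij : i = j <;> simp [hij, add_comm, mul_comm t]

/-- A polynomial of degree at most `n` can be evaluated at one from its values at `n + 1` points. -/
lemma exists_extrapolation (n : ℕ) {δ : ℝ} (hδ : 0 < δ) :
    ∃ c τ : ℕ → ℝ, (∀ i, 0 < τ i ∧ τ i < δ) ∧ ∑ i ∈ Finset.range (n + 1), c i = 1 ∧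
      ∀ p : Polynomial ℝ, p.natDegree ≤ n →
        p.eval 1 = ∑ i ∈ Finset.range (n + 1), c i * p.eval (τ i) := by
  let τ : ℕ → ℝ := fun i => δ / (i + 2)
  have hτ : Function.Injective τ := by
    intro i j hij
    have h1 : δ / ((i : ℝ) + 2) = δ / ((j : ℝ) + 2) := hij
    rw [div_eq_div_iff (by positivity) (by positivity)] at h1
    have h2 := mul_left_cancel₀ hδ.ne' h1
    exact_mod_cast (add_right_cancel h2).symm
  refine ⟨fun i => (Lagrange.basis (Finset.range (n + 1)) τ i).eval 1, τ, fun i => ⟨?_, ?_⟩, ?_,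
    fun p hp => ?_⟩
  · simp only [τ]
    positivity
  · simp only [τ]
    rw [div_lt_iff₀ (by positivity)]
    have : (0 : ℝ) ≤ i := i.cast_nonneg
    nlinarith
  · rw [← Polynomial.eval_finsetSum, Lagrange.sum_basis hτ.injOn (by simp), Polynomial.eval_one]
  · have h1 := Lagrange.eq_interpolate (s := Finset.range (n + 1)) (f := p) hτ.injOn (by
      rw [Finset.card_range]
      refine Polynomial.degree_le_natDegree.trans_lt ?_
      exact_mod_cast Nat.lt_succ_of_le hp)
    conv_lhs => rw [h1]
    rw [Lagrange.interpolate_apply, Polynomial.eval_finsetSum]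
    refine Finset.sum_congr rfl fun i _ => ?_
    rw [Polynomial.eval_mul, Polynomial.eval_C, mul_comm]

/-- If `det (1 + t A)` has average one for all small positive `t`, then the same holds at `t = 1`;
in particular the determinant cannot vanish there almost everywhere. -/
lemma measure_univ_eq_zero_of_lintegral_det {α : Type*} [MeasurableSpace α] {μ : Measure α}
    [IsFiniteMeasure μ] {A : α → (Fin n → ℝ) →L[ℝ] (Fin n → ℝ)} (hA : Measurable A) {C : ℝ}
    (hC : ∀ᵐ x ∂μ, ‖A x‖ ≤ C) {ε : ℝ} (hε : 0 < ε)
    (havg : ∀ t : ℝ, 0 < t → t < ε →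
      ∫⁻ x, ENNReal.ofReal |(1 + t • A x).det| ∂μ = μ univ)
    (hdet : ∀ᵐ x ∂μ, (1 + A x).det = 0) : μ univ = 0 := by
  have hcont : Continuous fun B : (Fin n → ℝ) →L[ℝ] (Fin n → ℝ) => (1 + B).det :=
    ContinuousLinearMap.continuous_det.comp (by fun_prop)
  obtain ⟨η, hη, hηpos⟩ : ∃ η > 0, ∀ B : (Fin n → ℝ) →L[ℝ] (Fin n → ℝ), ‖B‖ < η →
      0 < (1 + B).det := by
    have h1 : ∀ᶠ B in 𝓝 (0 : (Fin n → ℝ) →L[ℝ] (Fin n → ℝ)), 0 < (1 + B).det := by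
      refine hcont.continuousAt.eventually (lt_mem_nhds ?_)
      simp [ContinuousLinearMap.det]
    obtain ⟨η, hη, h2⟩ := Metric.eventually_nhds_iff.1 h1
    exact ⟨η, hη, fun B hB => h2 (by simpa using hB)⟩
  obtain ⟨c, τ, hτ, hc, hp⟩ := exists_extrapolation n
    (δ := min ε (η / (|C| + 1))) (by positivity)
  have hτε : ∀ i, τ i < ε := fun i => (hτ i).2.trans_le (min_le_left _ _)
  have hpos : ∀ i, ∀ᵐ x ∂μ, 0 ≤ (1 + τ i • A x).det := by
    intro i
    filter_upwards [hC] with x hx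
    refine (hηpos _ ?_).le
    have h1 := (lt_div_iff₀ (by positivity)).1 ((hτ i).2.trans_le (min_le_right _ _))
    rw [norm_smul, Real.norm_of_nonneg (hτ i).1.le]
    have h2 : ‖A x‖ ≤ |C| + 1 := by linarith [le_abs_self C]
    exact (mul_le_mul_of_nonneg_left h2 (hτ i).1.le).trans_lt h1
  have hmeas : ∀ t : ℝ, Measurable fun x => (1 + t • A x).det := fun t =>
    (hcont.measurable.comp (hA.const_smul t))
  have hval : ∀ i, ∫⁻ x, ENNReal.ofReal (1 + τ i • A x).det ∂μ = μ univ := by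
    intro i
    rw [← havg (τ i) (hτ i).1 (hτε i)]
    refine lintegral_congr_ae ?_
    filter_upwards [hpos i] with x hx
    rw [abs_of_nonneg hx]
  have hinteg : ∀ i, Integrable (fun x => (1 + τ i • A x).det) μ := fun i =>
    (lintegral_ofReal_ne_top_iff_integrable (hmeas _).aestronglyMeasurable (hpos i)).1
      (by rw [hval i]; exact measure_ne_top _ _)
  have hI : ∀ i, ∫ x, (1 + τ i • A x).det ∂μ = μ.real univ := by
    intro i
    rw [integral_eq_lintegral_of_nonneg_ae (hpos i) (hmeas _).aestronglyMeasurable, hval i]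
    rfl
  have h0 : ∫ x, (1 + A x).det ∂μ = 0 := integral_eq_zero_of_ae hdet
  have h1 : ∫ x, (1 + A x).det ∂μ = μ.real univ := by
    calc ∫ x, (1 + A x).det ∂μ
        = ∫ x, ∑ i ∈ Finset.range (n + 1), c i * (1 + τ i • A x).det ∂μ := by
          refine integral_congr_ae (Eventually.of_forall fun x => ?_)
          obtain ⟨p, hpn, hpe⟩ := exists_polynomial_det_one_add_smul (A x)
          have h2 := hp p hpn
          simp only [hpe, one_smul] at h2
          exact h2
      _ = ∑ i ∈ Finset.range (n + 1), c i * μ.real univ := by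
          rw [integral_finsetSum _ fun i _ => (hinteg i).const_mul _]
          simp only [integral_const_mul, hI]
      _ = μ.real univ := by rw [← Finset.sum_mul, hc, one_mul]
  rw [h0] at h1
  exact (measureReal_eq_zero_iff).1 h1.symm

end extrapolate

namespace IsUnimodularCocompactAction
open MeasureTheory

variable {n : ℕ} {Ω : Set (Fin n → ℝ)} {G : Type*} [Group G]
  {ρ : G →* ((Fin n → ℝ) ≃ᵃ[ℝ] (Fin n → ℝ))} {X : (Fin n → ℝ) → (Fin n → ℝ)}

lemma not_det_eq_zero_of_measurable (h : IsUnimodularCocompactAction Ω ρ)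
    (hX : LocallyLipschitzOn Ω X) (hXm : Measurable X)
    (hXρ : ∀ γ, ∀ x ∈ Ω, X (ρ γ x) = (ρ γ).linear (X x)) :
    ¬ ∀ x ∈ Ω, DifferentiableAt ℝ X x → (1 + fderiv ℝ X x).det = 0 := by
  intro hdet
  obtain ⟨ψ, K, hψ, hK, hKΩ, hψK, hψρ⟩ := h.exists_partition
  obtain ⟨ε, hε, hbij⟩ := h.exists_bijOn_add_smul_field hX hXρ
  set D := Ω ∩ {x | DifferentiableAt ℝ X x} with hDdef
  have hD : MeasurableSet D := h.isOpen.measurableSet.inter (measurableSet_of_differentiableAt ℝ X)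
  set μ := (volume.restrict D).withDensity ψ with hμ
  have hμuniv : μ univ = ∫⁻ x in D, ψ x := by
    rw [withDensity_apply _ MeasurableSet.univ, Measure.restrict_univ]
  have hψ1 : ∀ x ∈ D, ψ x ≤ K.indicator 1 x := by
    intro x hx
    by_cases hxK : x ∈ K
    · rw [indicator_of_mem hxK, Pi.one_apply, ← hψρ x hx.1]
      refine (le_of_eq ?_).trans (ENNReal.le_tsum (1 : G))
      simp
    · rw [hψK x hxK]
      exact zero_le
  have : IsFiniteMeasure μ := by
    refine ⟨?_⟩
    rw [hμuniv]
    calc ∫⁻ x in D, ψ x ≤ ∫⁻ x in D, K.indicator 1 x := setLIntegral_mono' hD hψ1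
      _ ≤ ∫⁻ x, K.indicator 1 x := setLIntegral_le_lintegral _ _
      _ = volume K := lintegral_indicator_one hK.measurableSet
      _ < ⊤ := hK.measure_lt_top
  have hmemD : ∀ᵐ x ∂μ, x ∈ D := by
    rw [ae_withDensity_iff hψ]
    filter_upwards [ae_restrict_mem hD] with x hx _ using hx
  have hmemK : ∀ᵐ x ∂μ, x ∈ K := by
    rw [ae_withDensity_iff hψ]
    refine Eventually.of_forall fun x hx => ?_
    by_contra hxK
    exact hx (hψK x hxK)
  obtain ⟨r, hr, hrΩ⟩ := hK.exists_cthickening_subset_open h.isOpen hKΩ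
  obtain ⟨C, hC⟩ := LocallyLipschitzOn.exists_lipschitzOnWith_of_compact
    (hK.cthickening (r := r)) (hX.mono hrΩ)
  have h0 : μ univ = 0 := by
    refine measure_univ_eq_zero_of_lintegral_det (A := fderiv ℝ X) (measurable_fderiv ℝ X)
      (C := C) ?_ hε ?_ ?_
    · filter_upwards [hmemK] with x hx
      refine norm_fderiv_le_of_lipschitzOn ℝ (mem_of_superset (Metric.closedBall_mem_nhds x hr)
        fun y hy => ?_) hC
      exact Metric.mem_cthickening_of_dist_le y x r K hx hy
    · intro t ht htε
      have hw : Measurable fun x => ENNReal.ofReal |(1 + t • fderiv ℝ X x).det| := by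
        have h1 : Continuous fun A : (Fin n → ℝ) →L[ℝ] (Fin n → ℝ) =>
            ENNReal.ofReal |(1 + t • A).det| :=
          ENNReal.continuous_ofReal.comp (continuous_abs.comp
            (ContinuousLinearMap.continuous_det.comp (by fun_prop)))
        exact h1.measurable.comp (measurable_fderiv ℝ X)
      rw [hμ, lintegral_withDensity_eq_lintegral_mul _ hψ hw, ← hμ, hμuniv,
        ← h.lintegral_det_mul_partition hX hXm hXρ (hbij t ht htε) hψ hψρ]
      refine lintegral_congr fun x => ?_
      rw [Pi.mul_apply, mul_comm]
    · filter_upwards [hmemD] with x hx using hdet x hx.1 hx.2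
  have hnull : volume (Ω \ D) = 0 := by
    rw [hDdef, sdiff_self_inter]
    exact hX.volume_not_differentiableAt_eq_zero h.isOpen
  have := h.countable
  have hvolD : volume D = 0 := by
    rw [hμuniv] at h0
    calc volume D = ∫⁻ x in D, 1 := (setLIntegral_one D).symm
      _ = ∫⁻ x in D, ∑' γ, ψ (ρ γ x) :=
        setLIntegral_congr_fun hD fun x hx => (hψρ x hx.1).symm
      _ = ∑' γ, ∫⁻ x in D, ψ (ρ γ x) := lintegral_tsum fun γ =>
        (hψ.comp (continuous_affineAction ρ γ).measurable).aemeasurable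
      _ = 0 := by
        refine ENNReal.tsum_eq_zero.2 fun γ => ?_
        rw [h.lintegral_comp (h.mem_differentiable_iff hXρ) hD hψ, h0]
  refine (h.isOpen.measure_pos volume h.nonempty).ne' ?_
  have h3 : Ω ⊆ D ∪ Ω \ D := fun x hx => by
    by_cases hxD : x ∈ D
    · exact Or.inl hxD
    · exact Or.inr ⟨hx, hxD⟩
  exact measure_mono_null h3 (measure_union_null hvolD hnull)

/-- For an equivariant locally Lipschitz field `X`, the map `x ↦ x + X(x)` has degree one on the
quotient; in particular it is not almost everywhere singular. -/
lemma not_det_eq_zero (h : IsUnimodularCocompactAction Ω ρ) (hX : LocallyLipschitzOn Ω X)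
    (hXρ : ∀ γ, ∀ x ∈ Ω, X (ρ γ x) = (ρ γ).linear (X x)) :
    ¬ ∀ x ∈ Ω, DifferentiableAt ℝ X x → (1 + fderiv ℝ X x).det = 0 := by
  intro hdet
  have heq : EqOn (Ω.indicator X) X Ω := fun x hx => indicator_of_mem hx X
  have hnhds : ∀ x ∈ Ω, Ω.indicator X =ᶠ[𝓝 x] X := fun x hx =>
    heq.eventuallyEq_of_mem (h.isOpen.mem_nhds hx)
  refine h.not_det_eq_zero_of_measurable (X := Ω.indicator X) ?_ ?_ ?_ fun x hx hd => ?_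
  · intro x hx
    obtain ⟨C, s, hs, hC⟩ := hX hx
    refine ⟨C, Ω ∩ s, inter_mem self_mem_nhdsWithin hs, fun y hy z hz => ?_⟩
    rw [heq hy.1, heq hz.1]
    exact hC hy.2 hz.2
  · classical
    rw [← piecewise_eq_indicator]
    exact hX.continuousOn.measurable_piecewise continuousOn_const h.isOpen.measurableSet
  · intro γ x hx
    rw [heq hx, heq ((h.mem_iff γ x).2 hx), hXρ γ x hx]
  · rw [(hnhds x hx).fderiv_eq]
    exact hdet x hx ((hnhds x hx).differentiableAt_iff.1 hd)

end IsUnimodularCocompactAction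

namespace IsUnimodularCocompactAction

variable {n : ℕ} {Ω : Set (Fin n → ℝ)} {G : Type*} [Group G]
  {ρ : G →* ((Fin n → ℝ) ≃ᵃ[ℝ] (Fin n → ℝ))}

lemma neg_mem_asympCone (h : IsUnimodularCocompactAction Ω ρ) (hc : Convex ℝ Ω) :
    ∀ u ∈ asympCone n Ω, -u ∈ asympCone n Ω := by
  intro u₀ hu₀
  by_contra hu₀'
  obtain ⟨u, hu, huρ, hu_mem⟩ := h.exists_equivariant_direction hu₀ hu₀'
  have hw : LocallyLipschitzOn Ω fun x => -u x := by
    intro x hx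
    obtain ⟨C, s, hs, hC⟩ := hu hx
    exact ⟨C, s, hs, fun y hy z hz => by simpa only [edist_neg_neg] using hC hy hz⟩
  have hg := locallyLipschitzOn_exitGauge h.isOpen hc hw
  have hX := hg.inv_smul_of_ne_zero hw fun x hx =>
    (exitGauge_pos h.isOpen hc hx (hu_mem x hx)).ne'
  have hexit := fun x (hx : x ∈ Ω) => exit_mem_frontier h.isOpen hc hx (hu_mem x hx)
  refine h.not_det_eq_zero hX (fun γ x hx => ?_) fun x hx hd => ?_
  · rw [huρ γ x hx, ← map_neg, exitGauge_equivariant (ρ γ) (h.mem_iff γ), map_smul]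
  · exact det_eq_zero_of_boundary_value h.isOpen h.nonempty hc hx
      ((hasFDerivAt_id x).add hd.hasFDerivAt) (fun y hy => (hexit y hy).1) (hexit x hx).2

theorem eq_univ (h : IsUnimodularCocompactAction Ω ρ) (hc : Convex ℝ Ω) : Ω = univ := by
  obtain ⟨K, hKΩ, hK, hcov⟩ := h.cocompact
  obtain ⟨lam, hlam, hrefl⟩ := exists_reflection_mem h.isOpen hc (h.neg_mem_asympCone hc) hK hKΩ
  refine eq_univ_of_reflection_mem h.nonempty h.isOpen hc hlam fun x hx y hy => ?_
  obtain ⟨γ, hγ⟩ := hcov x hx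
  have h1 := hrefl _ hγ _ ((h.mem_iff γ y).2 hy)
  rw [← h.mem_iff γ, affineAction_add, map_smul]
  convert h1 using 3
  have h2 := affineAction_add ρ γ y (x - y)
  rw [add_sub_cancel] at h2
  rw [h2, add_sub_cancel_left]

end IsUnimodularCocompactAction

section affAct

variable {n : ℕ}

/-- The linear part of an affine-form matrix. -/
def linearPart (g : GL (Fin (n + 1)) ℝ) : Matrix (Fin n) (Fin n) ℝ :=
  Matrix.of fun i j => g.val i.castSucc j.castSucc

lemma affAct_eq (g : GL (Fin (n + 1)) ℝ) (x : Fin n → ℝ) :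
    affAct n g x = Matrix.toLin' (linearPart g) x + affAct n g 0 := by
  ext i
  simp [affAct, linearPart, Matrix.mulVec, dotProduct]

lemma affAct_one (x : Fin n → ℝ) : affAct n 1 x = x := by
  ext i
  simp [affAct, Matrix.one_apply, Fin.castSucc_inj, (Fin.castSucc_lt_last i).ne]

lemma affAct_mul {g g' : GL (Fin (n + 1)) ℝ} (hg' : IsAffineForm n g') (x : Fin n → ℝ) :
    affAct n (g * g') x = affAct n g (affAct n g' x) := by
  ext i
  simp only [affAct, Units.val_mul, Matrix.mul_apply, Fin.sum_univ_castSucc, hg'.1, hg'.2,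
    mul_zero, add_zero, mul_one, mul_add, Finset.sum_add_distrib, Finset.mul_sum, Finset.sum_mul]
  rw [Finset.sum_comm, ← add_assoc]
  simp only [mul_assoc]

/-- The affine action of a group of affine-form matrices. -/
def affineAction (Γ : Subgroup (GL (Fin (n + 1)) ℝ)) (hΓ : ∀ γ ∈ Γ, IsAffineForm n γ) :
    Γ →* ((Fin n → ℝ) ≃ᵃ[ℝ] (Fin n → ℝ)) :=
  AffineEquiv.equivUnitsAffineMap.symm.toMonoidHom.comp <| MonoidHom.toHomUnits
    { toFun γ :=
        { toFun := affAct n γ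
          linear := Matrix.toLin' (linearPart γ.1)
          map_vadd' p v := by
            rw [affAct_eq, affAct_eq _ p, vadd_eq_add, vadd_eq_add, map_add, add_assoc] }
      map_one' := AffineMap.ext fun x => affAct_one x
      map_mul' γ δ := AffineMap.ext fun x => affAct_mul (hΓ δ δ.2) x }

lemma isUnimodularCocompactAction_affineAction {Ω : Set (Fin n → ℝ)} (ho : IsOpen Ω)
    (hne : Ω.Nonempty) {Γ : Subgroup (GL (Fin (n + 1)) ℝ)}
    (hΓ : (Γ : Set (GL (Fin (n + 1)) ℝ)) ⊆ AutSet n Ω)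
    (hpd : ActsProperlyDiscontinuously n Ω (Γ : Set (GL (Fin (n + 1)) ℝ)))
    (hcc : ActsCocompactly n Ω (Γ : Set (GL (Fin (n + 1)) ℝ)))
    (hdet : ∀ γ ∈ Γ, LinearPartDetOne n γ) :
    IsUnimodularCocompactAction Ω (affineAction Γ fun _ hγ => (hΓ hγ).1) := by
  set ρ := affineAction Γ fun _ hγ => (hΓ hγ).1
  have hρ : ∀ γ x, ρ γ x = affAct n γ x := fun _ _ => rfl
  have hmem : ∀ γ, ∀ x ∈ Ω, ρ γ x ∈ Ω := by
    intro γ x hx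
    rw [← (hΓ γ.2).2]
    exact ⟨x, hx, rfl⟩
  refine ⟨ho, hne, fun γ x => ⟨fun hx => ?_, hmem γ x⟩, fun K hKΩ hK => ?_, ?_, fun γ => ?_⟩
  · simpa only [affineAction_inv_apply_apply] using hmem γ⁻¹ _ hx
  · refine Set.Finite.of_finite_image ((hpd K K hKΩ hKΩ hK hK).subset ?_)
      Subtype.val_injective.injOn
    rintro _ ⟨γ, hγ, rfl⟩
    exact ⟨γ.2, hγ⟩
  · obtain ⟨K, hK, hKΩ, hcov⟩ := hcc
    refine ⟨K, hKΩ, hK, fun x hx => ?_⟩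
    rw [← hcov] at hx
    obtain ⟨γ, hγ, y, hy, rfl⟩ := mem_iUnion₂.1 hx
    refine ⟨⟨γ, hγ⟩⁻¹, ?_⟩
    change ρ _ (ρ ⟨γ, hγ⟩ y) ∈ K
    rwa [affineAction_inv_apply_apply]
  · exact (LinearMap.det_toLin' (linearPart γ.1)).trans (hdet γ γ.2)

end affAct

/-- The Markus conjecture holds for convex affine manifolds of dimension ≤ 5. -/
theorem markus_conjecture_convex_dim_le_five (n : ℕ) (hn : n ≤ 5) (Ω : Set (Fin n → ℝ))
    (hdom : IsConvexDomain n Ω)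
    (Γ : Subgroup (GL (Fin (n + 1)) ℝ))
    (hΓ : (Γ : Set (GL (Fin (n + 1)) ℝ)) ⊆ AutSet n Ω)
    (hfree : ActsFreely n Ω (Γ : Set (GL (Fin (n + 1)) ℝ)))
    (hpd : ActsProperlyDiscontinuously n Ω (Γ : Set (GL (Fin (n + 1)) ℝ)))
    (hcc : ActsCocompactly n Ω (Γ : Set (GL (Fin (n + 1)) ℝ)))
    (hdet : ∀ γ ∈ Γ, LinearPartDetOne n γ) :
    Ω = Set.univ :=
  (isUnimodularCocompactAction_affineAction hdom.2.1 hdom.1 hΓ hpd hcc hdet).eq_univ hdom.2.2
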